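/- Let X be a median graph and let h, k be halfspaces of X with h ⋔ k. Then there exist vertices a, b, c, d of X such that {a,b}, {b,c}, {c,d}, {d,a} are edges of X, the edges {a,b} and {c,d} are dual to the hyperplane {h, h̄}, and the edges {b,c} and {d,a} are dual to the hyperplane {k, k̄}. -/

import Mathlib

open scoped BigOperators

namespace MedianQM

variable {V : Type*}

/-- The interval `[x,y]`: vertices on geodesics from `x` to `y`. -/
def interval (X : SimpleGraph V) (x y : V) : Set V :=
  {m | X.dist x m + X.dist m y = X.dist x y}

/-- A median graph: connected, and any three vertices admit a unique median. -/
def IsMedianGraph (X : SimpleGraph V) : Prop :=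
  X.Connected ∧ ∀ x y z : V, ∃! m : V,
    m ∈ interval X x y ∧ m ∈ interval X y z ∧ m ∈ interval X x z

/-- A halfspace of `X`: the set of vertices strictly closer to one endpoint of
an edge than to the other. -/
def IsHalfspace (X : SimpleGraph V) (h : Set V) : Prop :=
  ∃ a b : V, X.Adj a b ∧ h = {v | X.dist v a < X.dist v b}

/-- The edge `{a,b}` is dual to the halfspace `h` (equivalently, to the
hyperplane `{h, h̄}`). -/
def EdgeDual (X : SimpleGraph V) (h : Set V) (a b : V) : Prop :=
  X.Adj a b ∧
    (h = {v | X.dist v a < X.dist v b} ∨ h = {v | X.dist v b < X.dist v a})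

/-- Two halfspaces are transverse. -/
def Transv (h k : Set V) : Prop :=
  (h ∩ k).Nonempty ∧ (hᶜ ∩ k).Nonempty ∧ (h ∩ kᶜ).Nonempty ∧ (hᶜ ∩ kᶜ).Nonempty

/-- `[x,y]_H`: the set of halfspaces separating `y` from `x`. -/
def sepH (X : SimpleGraph V) (x y : V) : Set (Set V) :=
  {h | IsHalfspace X h ∧ y ∈ h ∧ x ∉ h}

/-- `X` has dimension at most `D`: every (finite) family of pairwise transverse
halfspaces has at most `D` elements. -/
def DimLE (X : SimpleGraph V) (D : ℕ) : Prop :=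
  ∀ S : Finset (Set V), (∀ h ∈ S, IsHalfspace X h) →
    (∀ h ∈ S, ∀ k ∈ S, h ≠ k → Transv h k) → S.card ≤ D

/-- `h ⊋ k` are tightly nested: no halfspace lies strictly between them. -/
def TightlyNested (X : SimpleGraph V) (h k : Set V) : Prop :=
  k ⊂ h ∧ ¬ ∃ h' : Set V, IsHalfspace X h' ∧ h' ⊂ h ∧ k ⊂ h'

/-- A staircase of length `n`. -/
def IsStaircase (X : SimpleGraph V) (n : ℕ) (h k : Fin n → Set V) : Prop :=
  (∀ i, IsHalfspace X (h i)) ∧ (∀ i, IsHalfspace X (k i)) ∧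
  (∀ i j : Fin n, i < j → h j ⊂ h i) ∧ (∀ i j : Fin n, i < j → k j ⊂ k i) ∧
  (∀ i, k i ⊂ h i) ∧ (∀ i j : Fin n, j < i → Transv (h i) (k j))

/-- `X` has staircase length at most `σ`: there is no staircase of length `σ+1`. -/
def StaircaseLE (X : SimpleGraph V) (σ : ℕ) : Prop :=
  ∀ h k : Fin (σ + 1) → Set V, ¬ IsStaircase X (σ + 1) h k

/-- An `H`-segment of length `l`: a tuple of consecutively tightly nested
halfspaces `h₁ ⊋ ⋯ ⊋ h_l`. -/
def IsHSegment (X : SimpleGraph V) (l : ℕ) (s : Fin l → Set V) : Prop :=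
  (∀ i, IsHalfspace X (s i)) ∧
  ∀ i j : Fin l, (j : ℕ) = (i : ℕ) + 1 → TightlyNested X (s i) (s j)

/-- The segment `t` is contained in `[x,y]_H`. -/
def SegIn (X : SimpleGraph V) (x y : V) {l : ℕ} (t : Fin l → Set V) : Prop :=
  ∀ i, t i ∈ sepH X x y

/-- The translate of a segment by a group element. -/
def segSMul {Γ : Type*} [SMul Γ V] (γ : Γ) {l : ℕ} (s : Fin l → Set V) :
    Fin l → Set V :=
  fun i => (γ • ·) '' s i

/-- The set of translates of `s` contained in `[x,y]_H`. -/
def translatesIn (X : SimpleGraph V) (Γ : Type*) [SMul Γ V] {l : ℕ}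
    (s : Fin l → Set V) (x y : V) : Set (Fin l → Set V) :=
  {t | (∃ γ : Γ, t = segSMul γ s) ∧ SegIn X x y t}

/-- The median quasimorphism of the segment `s` (for the action of `Γ` on `X`). -/
noncomputable def fs (X : SimpleGraph V) (Γ : Type*) [SMul Γ V] {l : ℕ}
    (s : Fin l → Set V) (x y : V) : ℝ :=
  ((translatesIn X Γ s x y).ncard : ℝ) - ((translatesIn X Γ s y x).ncard : ℝ)

/-- The coboundary of a function of two variables, evaluated on a triple. -/
noncomputable def d1 (f : V → V → ℝ) (x y z : V) : ℝ := f y z - f x z + f x y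

/-- The simplicial coboundary operator. -/
noncomputable def cob {W : Type*} {m : ℕ} (β : (Fin (m + 1) → W) → ℝ) :
    (Fin (m + 2) → W) → ℝ :=
  fun x => ∑ j : Fin (m + 2), (-1 : ℝ) ^ (j : ℕ) * β (fun i => x (j.succAbove i))

/-- Γ-invariance of a cochain. -/
def IsInvariant (Γ : Type*) {W : Type*} [SMul Γ W] {m : ℕ}
    (β : (Fin m → W) → ℝ) : Prop :=
  ∀ (γ : Γ) (x : Fin m → W), β (fun i => γ • x i) = β x

/-- Boundedness of a real-valued function. -/
def IsBounded {α : Type*} (β : α → ℝ) : Prop := ∃ C : ℝ, ∀ x, |β x| ≤ C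

/-- A head of the segment `s`. -/
def IsHead (X : SimpleGraph V) {l : ℕ} (hl : 0 < l) (s : Fin l → Set V)
    (a : V) : Prop :=
  a ∉ s ⟨0, hl⟩ ∧ ∃ b, EdgeDual X (s ⟨0, hl⟩) a b

/-- A tail of the segment `s`. -/
def IsTail (X : SimpleGraph V) {l : ℕ} (hl : 0 < l) (s : Fin l → Set V)
    (a : V) : Prop :=
  a ∈ s ⟨l - 1, by omega⟩ ∧ ∃ b, EdgeDual X (s ⟨l - 1, by omega⟩) a b

/-- The cochain `κ` is non-transverse to the segment `s`. -/
def NonTransverseTo (X : SimpleGraph V) {n l : ℕ} (hl : 0 < l)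
    (κ : (Fin (n + 1) → V) → ℝ) (s : Fin l → Set V) : Prop :=
  (∀ (x : Fin n → V) (a a' : V), IsHead X hl s a → IsHead X hl s a' →
    κ (Fin.cons a x) = κ (Fin.cons a' x)) ∧
  (∀ (x : Fin n → V) (a a' : V), IsTail X hl s a → IsTail X hl s a' →
    κ (Fin.cons a x) = κ (Fin.cons a' x))

/-- The action of `Γ` on `X` is by graph automorphisms. -/
def ActsOn (Γ : Type*) [SMul Γ V] (X : SimpleGraph V) : Prop :=
  ∀ (γ : Γ) (a b : V), X.Adj a b → X.Adj (γ • a) (γ • b)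


/-- A set of vertices is convex if it contains every geodesic between its points. -/
def GeodConvex (X : SimpleGraph V) (S : Set V) : Prop :=
  ∀ x ∈ S, ∀ y ∈ S, interval X x y ⊆ S

theorem exists_adj_dist_add_one {X : SimpleGraph V} (hX : X.Connected) {x y : V} (hne : x ≠ y) :
    ∃ v, X.Adj x v ∧ X.dist v y + 1 = X.dist x y := by
  obtain ⟨p, hp⟩ := hX.exists_walk_length_eq_dist x y
  cases p with
  | nil => exact absurd rfl hne
  | @cons _ v _ hadj q =>
    refine ⟨v, hadj, ?_⟩
    rw [SimpleGraph.Walk.length_cons] at hp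
    have h1 := SimpleGraph.dist_le q
    have h2 := hX.dist_triangle (u := x) (v := v) (w := y)
    rw [SimpleGraph.dist_eq_one_iff_adj.mpr hadj] at h2
    omega

/-- A geodesic from a point of `S` to a point outside `S` contains an edge leaving `S`. -/
theorem exists_crossing_edge {X : SimpleGraph V} (hX : X.Connected) (S : Set V) (z : V)
    (hz : z ∉ S) (n : ℕ) : ∀ x ∈ S, X.dist x z = n →
    ∃ p ∈ S, ∃ q ∉ S, X.Adj p q ∧ X.dist x p + 1 + X.dist q z = X.dist x z := by
  induction n with
  | zero =>
    intro x hx h0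
    exact absurd ((hX.dist_eq_zero_iff.mp h0) ▸ hx) hz
  | succ n ih =>
    intro x hx hn
    obtain ⟨v, hadj, hv⟩ := exists_adj_dist_add_one hX (x := x) (y := z)
      (fun he => hz (he ▸ hx))
    by_cases hvS : v ∈ S
    · obtain ⟨p, hp, q, hq, hpq, hd⟩ := ih v hvS (by omega)
      refine ⟨p, hp, q, hq, hpq, ?_⟩
      have h1 := hX.dist_triangle (u := x) (v := v) (w := p)
      have h2 := hX.dist_triangle (u := x) (v := p) (w := z)
      have h3 := hX.dist_triangle (u := p) (v := q) (w := z)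
      rw [SimpleGraph.dist_eq_one_iff_adj.mpr hadj] at h1
      rw [SimpleGraph.dist_eq_one_iff_adj.mpr hpq] at h3
      omega
    · refine ⟨x, hx, v, hvS, hadj, ?_⟩
      rw [SimpleGraph.dist_self]
      omega

/-- The distances from a vertex to the endpoints of an edge differ by exactly one. -/
theorem IsMedianGraph.dist_adj {X : SimpleGraph V} (hmed : IsMedianGraph X) {a b : V}
    (hab : X.Adj a b) (v : V) :
    X.dist v b = X.dist v a + 1 ∨ X.dist v a = X.dist v b + 1 := by
  obtain ⟨m, ⟨h1, h2, h3⟩, -⟩ := hmed.2 v a b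
  simp only [interval, Set.mem_ofPred_eq] at h1 h2 h3
  have e1 := SimpleGraph.dist_eq_one_iff_adj.mpr hab
  have e2 := SimpleGraph.dist_comm (G := X) (u := m) (v := a)
  omega

theorem IsMedianGraph.compl_closer {X : SimpleGraph V} (hmed : IsMedianGraph X) {a b : V}
    (hab : X.Adj a b) :
    {v | X.dist v a < X.dist v b}ᶜ = {v | X.dist v b < X.dist v a} := by
  ext v
  have := hmed.dist_adj hab v
  simp only [Set.mem_compl_iff, Set.mem_ofPred_eq]
  omega

theorem IsMedianGraph.geodConvex_closer {X : SimpleGraph V} (hmed : IsMedianGraph X) {a b : V}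
    (hab : X.Adj a b) : GeodConvex X {v | X.dist v a < X.dist v b} := by
  intro x hx y hy z hz
  by_contra hzS
  have hX := hmed.1
  have comm : ∀ u v : V, X.dist u v = X.dist v u := fun u v => SimpleGraph.dist_comm
  have tri : ∀ u v w : V, X.dist u w ≤ X.dist u v + X.dist v w :=
    fun u v w => hX.dist_triangle
  obtain ⟨p, hp, q, hq, hpq, hd⟩ := exists_crossing_edge hX _ z hzS _ x hx rfl
  obtain ⟨r, hr, s, hs, hrs, hd'⟩ := exists_crossing_edge hX _ z hzS _ y hy rfl
  have epq := SimpleGraph.dist_eq_one_iff_adj.mpr hpq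
  have ers := SimpleGraph.dist_eq_one_iff_adj.mpr hrs
  simp only [interval, Set.mem_ofPred_eq] at hp hq hr hs hz
  have pq_a := hmed.dist_adj hpq a
  have pq_b := hmed.dist_adj hpq b
  have rs_a := hmed.dist_adj hrs a
  have rs_b := hmed.dist_adj hrs b
  have ab_p := hmed.dist_adj hab p
  have ab_q := hmed.dist_adj hab q
  have ab_r := hmed.dist_adj hab r
  have ab_s := hmed.dist_adj hab s
  rw [comm a p, comm a q] at pq_a
  rw [comm b p, comm b q] at pq_b
  rw [comm a r, comm a s] at rs_a
  rw [comm b r, comm b s] at rs_b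
  -- the geodesic from `p` to `r` through `q` and `s`
  have hgeo : X.dist p r = 1 + X.dist q s + 1 := by
    have t1 := tri x p y
    have t2 := tri p r y
    have t3 := tri q z s
    have t4 := tri p q r
    have t5 := tri q s r
    have c1 := comm z y
    have c2 := comm z s
    have c3 := comm y r
    have c4 := comm s r
    omega
  obtain ⟨m, ⟨m1, m2, m3⟩, -⟩ := hmed.2 p r a
  obtain ⟨m', ⟨n1, n2, n3⟩, -⟩ := hmed.2 q s b
  obtain ⟨o, -, huniq⟩ := hmed.2 p r b
  simp only [interval, Set.mem_ofPred_eq] at m1 m2 m3 n1 n2 n3 huniq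
  have ab_m := hmed.dist_adj hab m
  have ab_m' := hmed.dist_adj hab m'
  have hm : m = o := by
    apply huniq
    have t1 := tri p m b
    have t2 := tri r m b
    refine ⟨m1, ?_, ?_⟩ <;> omega
  have hm' : m' = o := by
    apply huniq
    have t1 := tri p m' b
    have t2 := tri r m' b
    have t3 := tri p q m'
    have t4 := tri r s m'
    have t5 := tri p m' r
    have c1 := comm m' r
    have c2 := comm m' s
    refine ⟨?_, ?_, ?_⟩ <;> omega
  rw [hm'] at n1 n2 n3 ab_m'
  rw [hm] at m1 m2 m3 ab_m
  have t1 := tri p o b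
  have t2 := tri q o a
  omega

theorem IsHalfspace.geodConvex {X : SimpleGraph V} (hmed : IsMedianGraph X) {h : Set V}
    (hh : IsHalfspace X h) : GeodConvex X h := by
  obtain ⟨a, b, hab, rfl⟩ := hh
  exact hmed.geodConvex_closer hab

theorem IsHalfspace.compl {X : SimpleGraph V} (hmed : IsMedianGraph X) {h : Set V}
    (hh : IsHalfspace X h) : IsHalfspace X hᶜ := by
  obtain ⟨a, b, hab, rfl⟩ := hh
  exact ⟨b, a, hab.symm, hmed.compl_closer hab⟩

/-- An edge leaving a halfspace is dual to it. -/
theorem IsHalfspace.eq_closer {X : SimpleGraph V} (hmed : IsMedianGraph X) {h : Set V}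
    (hh : IsHalfspace X h) {c d : V} (hcd : X.Adj c d) (hc : c ∈ h) (hd : d ∉ h) :
    h = {v | X.dist v c < X.dist v d} := by
  have e1 := SimpleGraph.dist_eq_one_iff_adj.mpr hcd
  have e2 := SimpleGraph.dist_eq_one_iff_adj.mpr hcd.symm
  ext v
  have hv := hmed.dist_adj hcd v
  simp only [Set.mem_ofPred_eq]
  constructor
  · intro hvh
    by_contra hlt
    refine hd (hh.geodConvex hmed v hvh c hc ?_)
    simp only [interval, Set.mem_ofPred_eq]
    omega
  · intro hlt
    by_contra hvh
    refine (hh.compl hmed).geodConvex hmed v hvh d hd (?_ : c ∈ _) hc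
    simp only [interval, Set.mem_ofPred_eq]
    omega

/-- The perimeter of the quadrilateral `x, y, z, w`. -/
noncomputable def perimeter (X : SimpleGraph V) (x y z w : V) : ℕ :=
  X.dist x y + X.dist y z + X.dist z w + X.dist w x

/-- The quadrilateral `x, y, z, w` has one vertex in each of the four sectors cut out by the sets
`h` and `k`. -/
def IsTransversal (h k : Set V) (x y z w : V) : Prop :=
  (x ∈ h ∧ x ∈ k) ∧ (y ∈ h ∧ y ∈ kᶜ) ∧ (z ∈ hᶜ ∧ z ∈ kᶜ) ∧ (w ∈ hᶜ ∧ w ∈ k)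

/-- A quadrilateral of least perimeter among those with one vertex in each sector. -/
def IsMinTransversal (X : SimpleGraph V) (h k : Set V) (x y z w : V) : Prop :=
  IsTransversal h k x y z w ∧
    ∀ x' y' z' w', IsTransversal h k x' y' z' w' → perimeter X x y z w ≤ perimeter X x' y' z' w'

theorem IsTransversal.swap {h k : Set V} {x y z w : V} (H : IsTransversal h k x y z w) :
    IsTransversal k h x w z y :=
  ⟨⟨H.1.2, H.1.1⟩, ⟨H.2.2.2.2, H.2.2.2.1⟩, ⟨H.2.2.1.2, H.2.2.1.1⟩, ⟨H.2.1.2, H.2.1.1⟩⟩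

theorem IsTransversal.rotate {h k : Set V} {x y z w : V} (H : IsTransversal h k x y z w) :
    IsTransversal kᶜ h y z w x := by
  simp only [IsTransversal, compl_compl] at H ⊢
  tauto

theorem perimeter_swap (X : SimpleGraph V) (x y z w : V) :
    perimeter X x w z y = perimeter X x y z w := by
  simp only [perimeter, SimpleGraph.dist_comm (u := x) (v := w),
    SimpleGraph.dist_comm (u := w) (v := z), SimpleGraph.dist_comm (u := z) (v := y),
    SimpleGraph.dist_comm (u := y) (v := x)]
  omega

theorem perimeter_rotate (X : SimpleGraph V) (x y z w : V) :
    perimeter X y z w x = perimeter X x y z w := by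
  simp only [perimeter]
  omega

theorem IsMinTransversal.swap {X : SimpleGraph V} {h k : Set V} {x y z w : V}
    (H : IsMinTransversal X h k x y z w) : IsMinTransversal X k h x w z y := by
  refine ⟨H.1.swap, fun x' y' z' w' H' => ?_⟩
  rw [perimeter_swap, ← perimeter_swap X x' y' z' w']
  exact H.2 _ _ _ _ H'.swap

theorem IsMinTransversal.rotate {X : SimpleGraph V} {h k : Set V} {x y z w : V}
    (H : IsMinTransversal X h k x y z w) : IsMinTransversal X kᶜ h y z w x := by
  refine ⟨H.1.rotate, fun x' y' z' w' H' => ?_⟩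
  rw [perimeter_rotate, perimeter_rotate X w' x' y' z']
  refine H.2 _ _ _ _ ?_
  simp only [IsTransversal, compl_compl] at H' ⊢
  tauto

theorem IsTransversal.exists_min (X : SimpleGraph V) {h k : Set V} {x y z w : V}
    (H : IsTransversal h k x y z w) : ∃ x y z w, IsMinTransversal X h k x y z w := by
  classical
  have hex : ∃ n, ∃ x y z w, IsTransversal h k x y z w ∧ perimeter X x y z w = n :=
    ⟨_, x, y, z, w, H, rfl⟩
  obtain ⟨x, y, z, w, H, hn⟩ := Nat.find_spec hex
  refine ⟨x, y, z, w, H, fun x' y' z' w' H' => ?_⟩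
  rw [hn]
  exact Nat.find_min' hex ⟨x', y', z', w', H', rfl⟩

/-- Each vertex of a minimal transversal quadrilateral lies between its neighbours. -/
theorem IsMinTransversal.dist_add_dist {X : SimpleGraph V} (hmed : IsMedianGraph X) {h k : Set V}
    (hh : GeodConvex X h) (hk : GeodConvex X k) {x y z w : V}
    (H : IsMinTransversal X h k x y z w) : X.dist w x + X.dist x y = X.dist w y := by
  obtain ⟨⟨⟨hxh, hxk⟩, hy, hz, hw⟩, hmin⟩ := H
  obtain ⟨m, ⟨h1, h2, h3⟩, -⟩ := hmed.2 w x y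
  have hle := hmin m y z w
    ⟨⟨hh x hxh y hy.1 h2, hk w hw.2 x hxk h1⟩, hy, hz, hw⟩
  have htri := hmed.1.dist_triangle (u := w) (v := x) (w := y)
  simp only [interval, Set.mem_ofPred_eq] at h1 h2 h3
  simp only [perimeter] at hle
  omega

/-- A minimal transversal quadrilateral is a rectangle. -/
theorem IsMinTransversal.rectangle {X : SimpleGraph V} (hmed : IsMedianGraph X) {h k : Set V}
    (hh : IsHalfspace X h) (hk : IsHalfspace X k) {x y z w : V}
    (H : IsMinTransversal X h k x y z w) :
    X.dist x y = X.dist z w ∧ X.dist x y + X.dist y z = X.dist x z := by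
  have ch := hh.geodConvex hmed
  have ck := hk.geodConvex hmed
  have ch' := (hh.compl hmed).geodConvex hmed
  have ck' := (hk.compl hmed).geodConvex hmed
  have e1 := H.dist_add_dist hmed ch ck
  have e2 := H.rotate.dist_add_dist hmed ck' ch
  have e3 := H.rotate.rotate.dist_add_dist hmed ch' ck'
  have e4 := H.rotate.rotate.rotate.dist_add_dist hmed (by rwa [compl_compl]) ch'
  have c1 := SimpleGraph.dist_comm (G := X) (u := w) (v := y)
  have c2 := SimpleGraph.dist_comm (G := X) (u := z) (v := x)
  omega

theorem IsMinTransversal.adj {X : SimpleGraph V} (hmed : IsMedianGraph X) {h k : Set V}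
    (hh : IsHalfspace X h) (hk : IsHalfspace X k) {x y z w : V}
    (H : IsMinTransversal X h k x y z w) : X.Adj x y := by
  obtain ⟨r1, r2⟩ := H.rectangle hmed hh hk
  obtain ⟨⟨hx, hy, hz, hw⟩, hmin⟩ := H
  have hX := hmed.1
  have hne : x ≠ y := fun he => hy.2 (he ▸ hx.2)
  obtain ⟨v, hadj, hv⟩ := exists_adj_dist_add_one hX hne
  have e1 := SimpleGraph.dist_eq_one_iff_adj.mpr hadj
  have e2 := SimpleGraph.dist_eq_one_iff_adj.mpr hadj.symm
  have hvh : v ∈ h := by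
    refine hh.geodConvex hmed x hx.1 y hy.1 ?_
    simp only [interval, Set.mem_ofPred_eq]
    omega
  by_cases hvk : v ∈ k
  · have H' : IsMinTransversal X h k v y z w := by
      refine ⟨⟨⟨hvh, hvk⟩, hy, hz, hw⟩, fun x' y' z' w' H' => le_trans ?_ (hmin _ _ _ _ H')⟩
      have t := hX.dist_triangle (u := w) (v := x) (w := v)
      simp only [perimeter]
      omega
    have := (H'.rectangle hmed hh hk).1
    omega
  · have H' : IsMinTransversal X h k x v z w := by
      refine ⟨⟨hx, ⟨hvh, hvk⟩, hz, hw⟩, fun x' y' z' w' H' => le_trans ?_ (hmin _ _ _ _ H')⟩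
      have t := hX.dist_triangle (u := v) (v := y) (w := z)
      simp only [perimeter]
      omega
    have := (H'.rectangle hmed hh hk).1
    exact SimpleGraph.dist_eq_one_iff_adj.mp (by omega)

/-- Lemma `lem:quadrangle_from_transversality`: in a median graph,
any pair of transverse halfspaces is witnessed by a quadrangle: there are vertices
`a, b, c, d` forming a 4-cycle whose opposite edges `{a,b}`, `{c,d}` are dual to the
hyperplane `{h, h̄}` and `{b,c}`, `{d,a}` are dual to the hyperplane `{k, k̄}`. -/
theorem statement8 {V : Type*} (X : SimpleGraph V) (hmed : IsMedianGraph X)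
    (h k : Set V) (hh : IsHalfspace X h) (hk : IsHalfspace X k)
    (htr : Transv h k) :
    ∃ a b c d : V,
      X.Adj a b ∧ X.Adj b c ∧ X.Adj c d ∧ X.Adj d a ∧
      EdgeDual X h a b ∧ EdgeDual X h c d ∧
      EdgeDual X k b c ∧ EdgeDual X k d a := by
  obtain ⟨⟨x₀, hx₀⟩, ⟨w₀, hw₀⟩, ⟨y₀, hy₀⟩, ⟨z₀, hz₀⟩⟩ := htr
  obtain ⟨x, y, z, w, H⟩ := IsTransversal.exists_min X (h := h) (k := k)
    (x := x₀) (y := y₀) (z := z₀) (w := w₀) ⟨hx₀, hy₀, hz₀, hw₀⟩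
  have hh' := hh.compl hmed
  have hk' := hk.compl hmed
  have xy := H.adj hmed hh hk
  have yz := H.rotate.adj hmed hk' hh
  have zw := H.rotate.rotate.adj hmed hh' hk'
  have wx := H.rotate.rotate.rotate.adj hmed (by rwa [compl_compl]) hh'
  obtain ⟨⟨hx, hy, hz, hw⟩, -⟩ := H
  exact ⟨w, x, y, z, wx, xy, yz, zw,
    ⟨wx, Or.inr (hh.eq_closer hmed wx.symm hx.1 hw.1)⟩,
    ⟨yz, Or.inl (hh.eq_closer hmed yz hy.1 hz.1)⟩,
    ⟨xy, Or.inl (hk.eq_closer hmed xy hx.2 hy.2)⟩,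
    ⟨zw, Or.inr (hk.eq_closer hmed zw.symm hw.2 hz.2)⟩⟩

end MedianQM
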